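/- arXiv:1603.09304 — 2 statements merged into one kernel-verified Lean document; each statement's English description precedes it below -/
import Mathlib

section
/- Let (E, {f_i}_{i=1}^m) ∈ 𝓔 with convex hull I. Suppose x ∈ f_i(I) ∩ f_{i+1}(I) = f_i∘f_m^u(I) = f_{i+1}∘f_1^v(I) for some i ∈ {1,…,m−1} and integers u, v ≥ 1. Then every coding (d_j) of x either begins with the word i m^{u−1} (i.e., d_1 = i and d_2 = ⋯ = d_u = m) or begins with the word (i+1) 1^{v−1} (i.e., d_1 = i+1 and d_2 = ⋯ = d_v = 1). -/
open Set Filter MeasureTheory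

/-- A self-similar iterated function system on `ℝ` given by `m` similitudes
`f i x = r i * x + t i` (for `1 ≤ i ≤ m`, `m ≥ 3`), together with its attractor `E`:
the unique nonempty compact set with `E = ⋃_{i=1}^m f_i(E)`. -/
structure ClassE where
  m : ℕ
  r : ℕ → ℝ
  t : ℕ → ℝ
  E : Set ℝ
  hm : 3 ≤ m
  hr : ∀ i, 1 ≤ i → i ≤ m → 0 < r i ∧ r i < 1
  hEne : E.Nonempty
  hEcpt : IsCompact E
  hEinv : E = ⋃ i ∈ Finset.Icc 1 m, (fun x => r i * x + t i) '' E

namespace ClassE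

/-- The `i`-th similitude. -/
def f (S : ClassE) (i : ℕ) (x : ℝ) : ℝ := S.r i * x + S.t i

/-- Left endpoint `a` of the convex hull of `E`. -/
noncomputable def a (S : ClassE) : ℝ := sInf S.E

/-- Right endpoint `b` of the convex hull of `E`. -/
noncomputable def b (S : ClassE) : ℝ := sSup S.E

/-- The convex hull `I = [a, b]` of `E`. -/
noncomputable def I (S : ClassE) : Set ℝ := Set.Icc S.a S.b

/-- Condition (A): `a = f_1(a) < f_2(a) < ⋯ < f_m(a) < f_m(b) = b`. -/
def condA (S : ClassE) : Prop :=
  S.f 1 S.a = S.a ∧ (∀ i, 1 ≤ i → i < S.m → S.f i S.a < S.f (i + 1) S.a) ∧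
    S.f S.m S.a < S.f S.m S.b ∧ S.f S.m S.b = S.b

/-- Condition (B): `f_i(I) ∩ f_{i+2}(I) = ∅` for all `1 ≤ i ≤ m - 2`. -/
def condB (S : ClassE) : Prop :=
  ∀ i, 1 ≤ i → i + 2 ≤ S.m → S.f i '' S.I ∩ S.f (i + 2) '' S.I = ∅

/-- Condition (C): there are `i, j ∈ {1, …, m-1}` with `f_i(I) ∩ f_{i+1}(I) = ∅` and
`f_j(I) ∩ f_{j+1}(I) ≠ ∅`. -/
def condC (S : ClassE) : Prop :=
  (∃ i, 1 ≤ i ∧ i + 1 ≤ S.m ∧ S.f i '' S.I ∩ S.f (i + 1) '' S.I = ∅) ∧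
    (∃ j, 1 ≤ j ∧ j + 1 ≤ S.m ∧ S.f j '' S.I ∩ S.f (j + 1) '' S.I ≠ ∅)

/-- Condition (D): whenever `f_i(I) ∩ f_{i+1}(I) ≠ ∅` there are `u, v ≥ 1` with
`f_i(I) ∩ f_{i+1}(I) = f_i ∘ f_m^u (I) = f_{i+1} ∘ f_1^v (I)`. -/
def condD (S : ClassE) : Prop :=
  ∀ i, 1 ≤ i → i + 1 ≤ S.m → S.f i '' S.I ∩ S.f (i + 1) '' S.I ≠ ∅ →
    ∃ u v : ℕ, 1 ≤ u ∧ 1 ≤ v ∧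
      S.f i '' S.I ∩ S.f (i + 1) '' S.I = (S.f i ∘ (S.f S.m)^[u]) '' S.I ∧
      S.f i '' S.I ∩ S.f (i + 1) '' S.I = (S.f (i + 1) ∘ (S.f 1)^[v]) '' S.I

/-- Membership in the class `𝓔`: conditions (A)–(D). -/
def goodE (S : ClassE) : Prop := S.condA ∧ S.condB ∧ S.condC ∧ S.condD

/-- `prefixMap d n = f_{d 0} ∘ f_{d 1} ∘ ⋯ ∘ f_{d (n-1)}`. -/
def prefixMap (S : ClassE) (d : ℕ → ℕ) : ℕ → ℝ → ℝ
  | 0 => id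
  | n + 1 => S.prefixMap d n ∘ S.f (d n)

/-- `d : ℕ → ℕ` (with digits in `{1, …, m}`) is a coding of `x` if
`x = lim_n f_{d 0} ∘ ⋯ ∘ f_{d (n-1)} (0)`. -/
def isCoding (S : ClassE) (d : ℕ → ℕ) (x : ℝ) : Prop :=
  (∀ n, 1 ≤ d n ∧ d n ≤ S.m) ∧
    Tendsto (fun n => S.prefixMap d n 0) atTop (nhds x)

/-- The set of codings of `x`. -/
def codings (S : ClassE) (x : ℝ) : Set (ℕ → ℕ) := {d | S.isCoding d x}

/-- `U k E`: the set of points of `E` having exactly `k` distinct codings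
(`k` a cardinal; e.g. `k = ℵ₀` for countably infinitely many codings,
`k = 𝔠 = 2^ℵ₀` for a continuum of codings). -/
def U (S : ClassE) (k : Cardinal) : Set ℝ :=
  {x ∈ S.E | Cardinal.mk (S.codings x) = k}

end ClassE

open ClassE

namespace ClassE

lemma aux_a_mem (S : ClassE) : S.a ∈ S.E := S.hEcpt.sInf_mem S.hEne
lemma aux_b_mem (S : ClassE) : S.b ∈ S.E := S.hEcpt.sSup_mem S.hEne

lemma aux_E_sub (S : ClassE) : S.E ⊆ S.I := fun _ hx =>
  ⟨csInf_le S.hEcpt.bddBelow hx, le_csSup S.hEcpt.bddAbove hx⟩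

lemma aux_a_le_b (S : ClassE) : S.a ≤ S.b := (S.aux_E_sub S.aux_a_mem).2

lemma aux_fE (S : ClassE) {k : ℕ} (h1 : 1 ≤ k) (h2 : k ≤ S.m) {y : ℝ} (hy : y ∈ S.E) :
    S.f k y ∈ S.E := by
  rw [S.hEinv]
  simp only [mem_iUnion]
  exact ⟨k, Finset.mem_Icc.2 ⟨h1, h2⟩, y, hy, rfl⟩

lemma aux_mono (S : ClassE) {k : ℕ} (h1 : 1 ≤ k) (h2 : k ≤ S.m) {p q : ℝ} (h : p ≤ q) :
    S.f k p ≤ S.f k q := by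
  have := (S.hr k h1 h2).1
  unfold f
  nlinarith

lemma aux_inj (S : ClassE) {k : ℕ} (h1 : 1 ≤ k) (h2 : k ≤ S.m) :
    Function.Injective (S.f k) := by
  intro p q h
  have := (S.hr k h1 h2).1
  unfold f at h
  exact mul_left_cancel₀ this.ne' (by linarith)

lemma aux_fI (S : ClassE) {k : ℕ} (h1 : 1 ≤ k) (h2 : k ≤ S.m) {y : ℝ} (hy : y ∈ S.I) :
    S.f k y ∈ S.I :=
  ⟨(S.aux_E_sub (S.aux_fE h1 h2 S.aux_a_mem)).1.trans (S.aux_mono h1 h2 hy.1),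
   (S.aux_mono h1 h2 hy.2).trans (S.aux_E_sub (S.aux_fE h1 h2 S.aux_b_mem)).2⟩

lemma aux_iterI (S : ClassE) {k : ℕ} (h1 : 1 ≤ k) (h2 : k ≤ S.m) (n : ℕ) {y : ℝ}
    (hy : y ∈ S.I) : (S.f k)^[n] y ∈ S.I := by
  induction n with
  | zero => exact hy
  | succ n ih => rw [Function.iterate_succ_apply']; exact S.aux_fI h1 h2 ih

lemma aux_left (S : ClassE) (hA : S.condA) {k : ℕ} (h1 : 1 ≤ k) (n : ℕ) (h2 : k + n ≤ S.m) :
    S.f k S.a ≤ S.f (k + n) S.a := by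
  induction n with
  | zero => exact le_rfl
  | succ n ih => exact (ih (by omega)).trans (hA.2.1 (k + n) (by omega) (by omega)).le

lemma aux_far (S : ClassE) (hA : S.condA) (hB : S.condB) {k l : ℕ} (h1 : 1 ≤ k)
    (hkl : k + 2 ≤ l) (h2 : l ≤ S.m) {x : ℝ} (hk : x ∈ S.f k '' S.I) (hl : x ∈ S.f l '' S.I) :
    False := by
  obtain ⟨p, hp, rfl⟩ := hk
  obtain ⟨q, hq, hqx⟩ := hl
  have e1 : S.f (k + 2) S.a ≤ S.f l S.a := by
    obtain ⟨n, rfl⟩ := Nat.exists_eq_add_of_le hkl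
    exact S.aux_left hA (by omega) n h2
  have e2 := S.aux_left hA h1 2 (by omega)
  have e3 := S.aux_mono (by omega : 1 ≤ l) h2 hq.1
  have hb := S.aux_mono h1 (by omega) hp.2
  have hr := (S.hr k h1 (by omega)).1
  have hmem : S.f (k + 2) S.a ∈ S.f k '' S.I ∩ S.f (k + 2) '' S.I := by
    refine ⟨⟨(S.f (k + 2) S.a - S.t k) / S.r k, ⟨?_, ?_⟩, ?_⟩, S.a, ⟨le_rfl, S.aux_a_le_b⟩, rfl⟩
    · rw [le_div_iff₀ hr]
      have : S.r k * S.a + S.t k ≤ S.f (k + 2) S.a := e2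
      linarith
    · rw [div_le_iff₀ hr]
      have : S.f (k + 2) S.a ≤ S.r k * S.b + S.t k := by
        have h : S.f (k + 2) S.a ≤ S.f k S.b := by linarith
        exact h
      linarith
    · change S.r k * ((S.f (k + 2) S.a - S.t k) / S.r k) + S.t k = _
      field_simp
      ring
  rw [hB k h1 (by omega)] at hmem
  exact hmem

lemma aux_prefix_succ (S : ClassE) (d : ℕ → ℕ) (n : ℕ) (y : ℝ) :
    S.prefixMap d (n + 1) y = S.f (d 0) (S.prefixMap (fun j => d (j + 1)) n y) := by
  induction n generalizing y with
  | zero => rfl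
  | succ n ih =>
    change S.prefixMap d (n + 1) (S.f (d (n + 1)) y) = _
    rw [ih]; rfl

lemma aux_shift (S : ClassE) {d : ℕ → ℕ} {x : ℝ} (h : S.isCoding d x) :
    ∃ y, S.f (d 0) y = x ∧ S.isCoding (fun j => d (j + 1)) y := by
  obtain ⟨hd, ht⟩ := h
  have hr := (S.hr (d 0) (hd 0).1 (hd 0).2).1
  refine ⟨(x - S.t (d 0)) / S.r (d 0), ?_, fun n => hd (n + 1), ?_⟩
  · unfold f
    field_simp
    ring
  · have h2 := (((tendsto_add_atTop_iff_nat 1).2 ht).sub_const (S.t (d 0))).div_const (S.r (d 0))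
    refine h2.congr fun n => ?_
    rw [aux_prefix_succ]
    unfold f
    field_simp
    ring

lemma aux_codI (S : ClassE) {d : ℕ → ℕ} {x : ℝ} (h : S.isCoding d x) : x ∈ S.I := by
  obtain ⟨hd, ht⟩ := h
  obtain ⟨k, hk, hmax⟩ := Finset.exists_max_image (Finset.Icc 1 S.m) S.r
    ⟨1, Finset.mem_Icc.2 ⟨le_rfl, by have := S.hm; omega⟩⟩
  rw [Finset.mem_Icc] at hk
  obtain ⟨hk0, hk1⟩ := S.hr k hk.1 hk.2
  have hc : ∀ n p q, |S.prefixMap d n p - S.prefixMap d n q| ≤ S.r k ^ n * |p - q| := by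
    intro n
    induction n with
    | zero => intro p q; simp [prefixMap]
    | succ n ih =>
      intro p q
      refine (ih (S.f (d n) p) (S.f (d n) q)).trans ?_
      have e : S.f (d n) p - S.f (d n) q = S.r (d n) * (p - q) := by unfold f; ring
      have h0 := (S.hr _ (hd n).1 (hd n).2).1
      rw [e, abs_mul, abs_of_pos h0, pow_succ, mul_assoc]
      have := hmax (d n) (Finset.mem_Icc.2 (hd n))
      gcongr
  have hI : ∀ n p, p ∈ S.I → S.prefixMap d n p ∈ S.I := by
    intro n
    induction n with
    | zero => intro p hp; exact hp
    | succ n ih => intro p hp; exact ih _ (S.aux_fI (hd n).1 (hd n).2 hp)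
  have h0 : Tendsto (fun n => S.prefixMap d n S.a - S.prefixMap d n 0) atTop (nhds 0) := by
    refine squeeze_zero_norm (fun n => hc n S.a 0) ?_
    simpa using (tendsto_pow_atTop_nhds_zero_of_lt_one hk0.le hk1).mul_const |S.a - 0|
  have h3 := h0.add ht
  simp only [sub_add_cancel, zero_add] at h3
  exact isClosed_Icc.mem_of_tendsto h3
    (Eventually.of_forall fun n => hI n _ ⟨le_rfl, S.aux_a_le_b⟩)

lemma aux_runm (S : ClassE) (hS : S.goodE) (n : ℕ) : ∀ (d : ℕ → ℕ) (y : ℝ), S.isCoding d y →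
    y ∈ (S.f S.m)^[n] '' S.I → ∀ j, j + 1 < n → d j = S.m := by
  obtain ⟨hA, hB, -, hD⟩ := hS
  have hm := S.hm
  induction n with
  | zero => intro d y _ _ j hj; omega
  | succ n ih =>
    intro d y hd hy j hj
    obtain ⟨n, rfl⟩ : ∃ k, n = k + 1 := ⟨n - 1, by omega⟩
    obtain ⟨z, hz, rfl⟩ := hy
    rw [Function.iterate_succ_apply'] at hd
    obtain ⟨w, hw, hdw⟩ := S.aux_shift hd
    have hwI := S.aux_codI hdw
    have hzI := S.aux_iterI (by omega) (le_refl S.m) (n + 1) hz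
    have h0 : d 0 = S.m := by
      by_contra hne
      have hb := hd.1 0
      by_cases hlt : d 0 + 2 ≤ S.m
      · exact S.aux_far hA hB hb.1 hlt le_rfl ⟨w, hwI, hw⟩ ⟨_, hzI, rfl⟩
      have he : d 0 + 1 = S.m := by omega
      have hmem : S.f S.m ((S.f S.m)^[n+1] z) ∈ S.f (d 0) '' S.I ∩ S.f (d 0 + 1) '' S.I :=
        ⟨⟨w, hwI, hw⟩, by rw [he]; exact ⟨_, hzI, rfl⟩⟩
      obtain ⟨u, v, hu, hv, -, e2⟩ := hD (d 0) hb.1 (by omega) (Set.nonempty_iff_ne_empty.1 ⟨_, hmem⟩)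
      rw [e2] at hmem
      obtain ⟨q, hq, hqe⟩ := hmem
      obtain ⟨v, rfl⟩ : ∃ k, v = k + 1 := ⟨v - 1, by omega⟩
      rw [he] at hqe
      have := S.aux_inj (by omega) le_rfl hqe
      rw [Function.iterate_succ_apply', Function.iterate_succ_apply'] at this
      exact S.aux_far hA hB le_rfl (by omega) le_rfl
        ⟨_, S.aux_iterI le_rfl (by omega) v hq, this⟩
        ⟨_, S.aux_iterI (by omega) le_rfl n hz, rfl⟩
    rw [h0] at hw
    have hwz := S.aux_inj (by omega) le_rfl hw
    cases j with
    | zero => exact h0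
    | succ j => exact ih _ w hdw ⟨z, hz, hwz.symm⟩ j (by omega)

lemma aux_run1 (S : ClassE) (hS : S.goodE) (n : ℕ) : ∀ (d : ℕ → ℕ) (y : ℝ), S.isCoding d y →
    y ∈ (S.f 1)^[n] '' S.I → ∀ j, j + 1 < n → d j = 1 := by
  obtain ⟨hA, hB, -, hD⟩ := hS
  have hm := S.hm
  induction n with
  | zero => intro d y _ _ j hj; omega
  | succ n ih =>
    intro d y hd hy j hj
    obtain ⟨n, rfl⟩ : ∃ k, n = k + 1 := ⟨n - 1, by omega⟩
    obtain ⟨z, hz, rfl⟩ := hy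
    rw [Function.iterate_succ_apply'] at hd
    obtain ⟨w, hw, hdw⟩ := S.aux_shift hd
    have hwI := S.aux_codI hdw
    have hzI := S.aux_iterI le_rfl (by omega : 1 ≤ S.m) (n + 1) hz
    have h0 : d 0 = 1 := by
      by_contra hne
      have hb := hd.1 0
      by_cases hlt : 1 + 2 ≤ d 0
      · exact S.aux_far hA hB le_rfl hlt hb.2 ⟨_, hzI, rfl⟩ ⟨w, hwI, hw⟩
      have he : d 0 = 1 + 1 := by omega
      have hmem : S.f 1 ((S.f 1)^[n+1] z) ∈ S.f 1 '' S.I ∩ S.f (1 + 1) '' S.I :=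
        ⟨⟨_, hzI, rfl⟩, by rw [← he]; exact ⟨w, hwI, hw⟩⟩
      obtain ⟨u, v, hu, hv, e1, -⟩ := hD 1 le_rfl (by omega) (Set.nonempty_iff_ne_empty.1 ⟨_, hmem⟩)
      rw [e1] at hmem
      obtain ⟨q, hq, hqe⟩ := hmem
      obtain ⟨u, rfl⟩ : ∃ k, u = k + 1 := ⟨u - 1, by omega⟩
      have := S.aux_inj le_rfl (by omega) hqe
      rw [Function.iterate_succ_apply', Function.iterate_succ_apply'] at this
      exact S.aux_far hA hB le_rfl (by omega) le_rfl
        ⟨_, S.aux_iterI le_rfl (by omega) n hz, rfl⟩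
        ⟨_, S.aux_iterI (by omega) le_rfl u hq, this⟩
    rw [h0] at hw
    have hwz := S.aux_inj le_rfl (by omega) hw
    cases j with
    | zero => exact h0
    | succ j => exact ih _ w hdw ⟨z, hz, hwz.symm⟩ j (by omega)

end ClassE

theorem stmt6 (S : ClassE) (hS : S.goodE) (i u v : ℕ) (x : ℝ)
    (hi : 1 ≤ i) (him : i + 1 ≤ S.m) (hu : 1 ≤ u) (hv : 1 ≤ v)
    (hx : x ∈ S.f i '' S.I ∩ S.f (i + 1) '' S.I)
    (h1 : S.f i '' S.I ∩ S.f (i + 1) '' S.I = (S.f i ∘ (S.f S.m)^[u]) '' S.I)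
    (h2 : S.f i '' S.I ∩ S.f (i + 1) '' S.I = (S.f (i + 1) ∘ (S.f 1)^[v]) '' S.I) :
    ∀ d ∈ S.codings x,
      (d 0 = i ∧ ∀ j, 1 ≤ j → j < u → d j = S.m) ∨
      (d 0 = i + 1 ∧ ∀ j, 1 ≤ j → j < v → d j = 1) := by
  intro d hd
  have hd' : S.isCoding d x := hd
  obtain ⟨y, hy, hdy⟩ := S.aux_shift hd'
  have hyI := S.aux_codI hdy
  have hb := hd'.1 0
  obtain ⟨hA, hB, -, -⟩ := id hS
  have hc : d 0 = i ∨ d 0 = i + 1 := by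
    by_contra hne
    push Not at hne
    rcases Nat.lt_or_ge (d 0) i with h | h
    · exact S.aux_far hA hB hb.1 (by omega) him ⟨y, hyI, hy⟩ hx.2
    · exact S.aux_far hA hB hi (by omega) hb.2 hx.1 ⟨y, hyI, hy⟩
  rcases hc with h | h
  · left
    refine ⟨h, fun j hj1 hju => ?_⟩
    rw [h1] at hx
    obtain ⟨q, hq, hqx⟩ := hx
    rw [h, ← hqx] at hy
    have e := S.aux_inj hi (by omega) hy
    obtain ⟨j, rfl⟩ : ∃ k, j = k + 1 := ⟨j - 1, by omega⟩
    exact S.aux_runm hS u _ y hdy ⟨q, hq, e.symm⟩ j hju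
  · right
    refine ⟨h, fun j hj1 hju => ?_⟩
    rw [h2] at hx
    obtain ⟨q, hq, hqx⟩ := hx
    rw [h, ← hqx] at hy
    have e := S.aux_inj (by omega) him hy
    obtain ⟨j, rfl⟩ : ∃ k, j = k + 1 := ⟨j - 1, by omega⟩
    exact S.aux_run1 hS v _ y hdy ⟨q, hq, e.symm⟩ j hju
end

section
/- Let (E, {f_i}_{i=1}^m) ∈ 𝓔. Then for every integer k ≥ 1, dim_H U_k(E) ≤ dim_H U_1(E). -/
open Set Filter MeasureTheory

open ClassE

namespace ClassE

lemma pm_affine (S : ClassE) (d : ℕ → ℕ) (n : ℕ) (z : ℝ) :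
    S.prefixMap d n z = (∏ i ∈ Finset.range n, S.r (d i)) * z + S.prefixMap d n 0 := by
  induction n generalizing z with
  | zero => simp [prefixMap]
  | succ n ih =>
    simp only [prefixMap, Function.comp]
    rw [ih (S.f (d n) z), ih (S.f (d n) 0), Finset.prod_range_succ]
    simp only [f]
    ring

lemma pm_add (S : ClassE) (d : ℕ → ℕ) (n j : ℕ) (z : ℝ) :
    S.prefixMap d (n + j) z = S.prefixMap d n (S.prefixMap (fun i => d (n + i)) j z) := by
  induction j generalizing z with
  | zero => simp [prefixMap]
  | succ j ih =>
    have : n + (j + 1) = (n + j) + 1 := by ring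
    rw [this]
    simp only [prefixMap, Function.comp]
    rw [ih]

lemma pm_congr (S : ClassE) (d e : ℕ → ℕ) (n : ℕ) (h : ∀ i < n, d i = e i) :
    S.prefixMap d n = S.prefixMap e n := by
  induction n with
  | zero => rfl
  | succ n ih =>
    simp only [prefixMap]
    rw [ih (fun i hi => h i (by omega)), h n (by omega)]

/-- Word maps. -/
def wm (S : ClassE) (w : List ℕ) : ℝ → ℝ := w.foldl (fun h i => h ∘ S.f i) id

lemma pm_eq_wm (S : ClassE) (d : ℕ → ℕ) (n : ℕ) :
    S.prefixMap d n = S.wm ((List.range n).map d) := by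
  induction n with
  | zero => rfl
  | succ n ih =>
    simp only [prefixMap]
    rw [ih]
    simp [wm, List.range_succ]

lemma f_lip (S : ClassE) (i : ℕ) : ∃ K, LipschitzWith K (S.f i) := by
  refine ⟨‖S.r i‖₊, LipschitzWith.of_dist_le_mul fun x y => ?_⟩
  simp only [f, Real.dist_eq, coe_nnnorm, Real.norm_eq_abs]
  rw [← abs_mul]
  apply le_of_eq
  congr 1
  ring

lemma wm_lip (S : ClassE) (w : List ℕ) : ∃ K, LipschitzWith K (S.wm w) := by
  induction w using List.reverseRecOn with
  | nil => exact ⟨1, LipschitzWith.id⟩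
  | append_singleton w i ih =>
    obtain ⟨K, hK⟩ := ih
    obtain ⟨L, hL⟩ := S.f_lip i
    refine ⟨K * L, ?_⟩
    have := hK.comp hL
    simpa [wm] using this

lemma f_mem (S : ClassE) {i : ℕ} (h1 : 1 ≤ i) (h2 : i ≤ S.m) {x : ℝ} (hx : x ∈ S.E) :
    S.f i x ∈ S.E := by
  rw [S.hEinv]
  simp only [mem_iUnion]
  exact ⟨i, Finset.mem_Icc.2 ⟨h1, h2⟩, x, hx, rfl⟩

lemma pm_mem (S : ClassE) {d : ℕ → ℕ} (hd : ∀ n, 1 ≤ d n ∧ d n ≤ S.m) (n : ℕ) {x : ℝ}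
    (hx : x ∈ S.E) : S.prefixMap d n x ∈ S.E := by
  induction n generalizing x with
  | zero => exact hx
  | succ n ih => exact ih (S.f_mem (hd n).1 (hd n).2 hx)

lemma prod_tendsto (S : ClassE) {d : ℕ → ℕ} (hd : ∀ n, 1 ≤ d n ∧ d n ≤ S.m) :
    Tendsto (fun n => ∏ i ∈ Finset.range n, S.r (d i)) atTop (nhds 0) := by
  have hm := S.hm
  obtain ⟨j, hj, hmax⟩ := Finset.exists_max_image (Finset.Icc 1 S.m) S.r
    ⟨1, Finset.mem_Icc.2 ⟨le_rfl, by omega⟩⟩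
  rw [Finset.mem_Icc] at hj
  have hrj := S.hr j hj.1 hj.2
  refine squeeze_zero (fun n => Finset.prod_nonneg fun i _ =>
    (S.hr _ (hd i).1 (hd i).2).1.le) (fun n => ?_)
    (tendsto_pow_atTop_nhds_zero_of_lt_one hrj.1.le hrj.2)
  calc ∏ i ∈ Finset.range n, S.r (d i) ≤ ∏ i ∈ Finset.range n, S.r j :=
        Finset.prod_le_prod (fun i _ => (S.hr _ (hd i).1 (hd i).2).1.le)
          (fun i _ => hmax _ (Finset.mem_Icc.2 (hd i)))
    _ = S.r j ^ n := by simp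

lemma coding_mem (S : ClassE) {d : ℕ → ℕ} {x : ℝ} (h : S.isCoding d x) : x ∈ S.E := by
  obtain ⟨e, he⟩ := S.hEne
  have h1 : Tendsto (fun n => S.prefixMap d n e) atTop (nhds x) := by
    have := ((S.prod_tendsto h.1).mul_const e).add h.2
    simp only [zero_mul, zero_add] at this
    exact this.congr fun n => (S.pm_affine d n e).symm
  exact S.hEcpt.isClosed.mem_of_tendsto h1 (Eventually.of_forall fun n => S.pm_mem h.1 n he)

lemma coding_shift (S : ClassE) {d : ℕ → ℕ} {x : ℝ} (h : S.isCoding d x) (n : ℕ) :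
    ∃ y, S.isCoding (fun i => d (n + i)) y ∧ S.prefixMap d n y = x := by
  have hp : (∏ i ∈ Finset.range n, S.r (d i)) ≠ 0 :=
    (Finset.prod_pos fun i _ => (S.hr _ (h.1 i).1 (h.1 i).2).1).ne'
  set p := ∏ i ∈ Finset.range n, S.r (d i) with hpdef
  refine ⟨(x - S.prefixMap d n 0) / p, ⟨fun i => h.1 _, ?_⟩, ?_⟩
  · have h1 : Tendsto (fun j => S.prefixMap d (n + j) 0) atTop (nhds x) := by
      have := (tendsto_add_atTop_iff_nat (f := fun j => S.prefixMap d j 0) n).2 h.2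
      simpa [add_comm] using this
    refine ((h1.sub_const (S.prefixMap d n 0)).div_const p).congr fun j => ?_
    rw [pm_add, pm_affine, ← hpdef]
    field_simp
    ring
  · rw [pm_affine, ← hpdef]
    field_simp
    ring

lemma U_sub (S : ClassE) (k : ℕ) (hk : 1 ≤ k) :
    S.U k ⊆ ⋃ w : List ℕ, S.wm w '' S.U 1 := by
  rintro x ⟨-, hx⟩
  have hfin : (S.codings x).Finite := by
    rw [← Cardinal.lt_aleph0_iff_set_finite, hx]
    exact Cardinal.natCast_lt_aleph0
  have hne : (S.codings x).Nonempty := by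
    rw [← Set.nonempty_coe_sort, ← Cardinal.mk_ne_zero_iff, hx]
    exact_mod_cast (by omega : k ≠ 0)
  obtain ⟨d, hd⟩ := hne
  have hex : ∀ e : ℕ → ℕ, ∃ n, e ≠ d → e n ≠ d n := by
    intro e
    by_cases h : e = d
    · exact ⟨0, fun h' => absurd h h'⟩
    · obtain ⟨n, hn⟩ := Function.ne_iff.1 h
      exact ⟨n, fun _ => hn⟩
  choose N hN using hex
  obtain ⟨B, hB⟩ := (hfin.image N).bddAbove
  set n := B + 1 with hn
  have key : ∀ e ∈ S.codings x, (∀ i < n, e i = d i) → e = d := by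
    intro e he hi
    by_contra hc
    have : N e ≤ B := hB ⟨e, he, rfl⟩
    exact hN e hc (hi _ (by omega))
  obtain ⟨y, hy, hyx⟩ := S.coding_shift hd n
  refine mem_iUnion.2 ⟨(List.range n).map d, y, ⟨S.coding_mem hy, ?_⟩, ?_⟩
  · have : S.codings y = {fun i => d (n + i)} := by
      refine Set.eq_singleton_iff_unique_mem.2 ⟨hy, fun e he => ?_⟩
      set c : ℕ → ℕ := fun j => if j < n then d j else e (j - n) with hc
      have hcs : (fun i => c (n + i)) = e := by
        funext i
        simp [hc]
      have hcd : ∀ i < n, c i = d i := fun i hi => by simp [hc, hi]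
      have hcx : c ∈ S.codings x := by
        refine ⟨fun j => ?_, ?_⟩
        · by_cases h : j < n
          · simpa [hc, h] using hd.1 j
          · simpa [hc, h] using he.1 (j - n)
        · rw [← tendsto_add_atTop_iff_nat n]
          have hcont : Continuous (S.prefixMap d n) := by
            rw [pm_eq_wm]
            obtain ⟨K, hK⟩ := S.wm_lip ((List.range n).map d)
            exact hK.continuous
          have h2 := (hcont.tendsto y).comp he.2
          rw [hyx] at h2
          refine h2.congr fun j => ?_
          rw [add_comm j n, pm_add, hcs, S.pm_congr c d n hcd]
          rfl
      rw [← hcs, key c hcx hcd]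
    rw [this]
    simp
  · rw [← pm_eq_wm, hyx]

end ClassE

theorem stmt7 (S : ClassE) (hS : S.goodE) :
    ∀ k : ℕ, 1 ≤ k → dimH (S.U k) ≤ dimH (S.U 1) := by
  intro k hk
  refine (dimH_mono (S.U_sub k hk)).trans ?_
  rw [dimH_iUnion]
  refine iSup_le fun w => ?_
  obtain ⟨K, hK⟩ := S.wm_lip w
  exact hK.dimH_image_le _
end
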